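/- arXiv:2410.20795 — 2 statements merged into one kernel-verified Lean document; each statement's English description precedes it below -/
import Mathlib

section
/- Let 0 < α < 1. Then there exists a constant C > 0 such that for every r ∈ ℝ one has |E_{α,1}(i r)| ≤ C / (1 + |r|) and |E_{α,α}(i r)| ≤ C / (1 + |r|); in particular, E_{α,1} and E_{α,α} are bounded on the imaginary axis. -/
/-- The Mittag–Leffler function `E_{a,b}(z) = ∑_{k=0}^∞ z^k / Γ(ka + b)`. -/
noncomputable def mittagLeffler (a b : ℝ) (z : ℂ) : ℂ :=
  ∑' k : ℕ, z ^ k / (Real.Gamma (k * a + b) : ℂ)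


section

open Complex MeasureTheory Set Filter Topology ProbabilityTheory FourierTransform

lemma integrableOn_rpow_mul_exp_neg_mul {w a : ℝ} (hw : 0 < w) (ha : 0 < a) :
    IntegrableOn (fun x : ℝ ↦ x ^ (w - 1) * Real.exp (-a * x)) (Ioi 0) := by
  simpa using integrableOn_rpow_mul_exp_neg_mul_rpow (s := w - 1) (p := 1) (b := a)
    (by linarith) one_pos ha

/-- The Laplace transform of a power function, at a complex point of the right half-plane. -/
lemma integral_rpow_mul_cexp_neg_mul_Ioi {w : ℝ} (hw : 0 < w) {z : ℂ} (hz : 0 < z.re) :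
    ∫ x : ℝ in Ioi 0, ((x ^ (w - 1) : ℝ) : ℂ) * cexp (-z * x) =
      Real.Gamma w * z ^ (-(w : ℂ)) := by
  let ν : Measure ℝ := (volume.restrict (Ioi 0)).withDensity fun x ↦ ENNReal.ofReal (x ^ (w - 1))
  have hmeas : Measurable fun x : ℝ ↦ ENNReal.ofReal (x ^ (w - 1)) := by fun_prop
  have hfin : ∀ᵐ x : ℝ ∂volume.restrict (Ioi 0), ENNReal.ofReal (x ^ (w - 1)) < ⊤ := by simp
  have hset : Iio 0 ⊆ integrableExpSet id ν := by
    intro t ht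
    have h := integrableOn_rpow_mul_exp_neg_mul hw (neg_pos.2 ht)
    simp only [integrableExpSet, Set.mem_ofPred_eq, ν]
    rw [integrable_withDensity_iff_integrable_smul' hmeas hfin]
    refine h.congr_fun (fun x hx ↦ ?_) measurableSet_Ioi
    simp [ENNReal.toReal_ofReal (Real.rpow_nonneg (le_of_lt hx) _)]
  have hint : ∀ z : ℂ, complexMGF id ν (-z) =
      ∫ x : ℝ in Ioi 0, ((x ^ (w - 1) : ℝ) : ℂ) * cexp (-z * x) := by
    intro z
    rw [complexMGF, integral_withDensity_eq_integral_toReal_smul hmeas hfin]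
    refine setIntegral_congr_fun measurableSet_Ioi fun x hx ↦ ?_
    simp [ENNReal.toReal_ofReal (Real.rpow_nonneg (le_of_lt hx) _)]
  have hopen : IsOpen {z : ℂ | 0 < z.re} := isOpen_lt continuous_const continuous_re
  have hf : AnalyticOnNhd ℂ (fun z ↦ complexMGF id ν (-z)) {z : ℂ | 0 < z.re} := by
    intro z hz
    refine (analyticAt_complexMGF ?_).fun_comp (by fun_prop)
    refine interior_mono hset ?_
    rw [interior_Iio]
    simpa using hz
  have hg : AnalyticOnNhd ℂ (fun z : ℂ ↦ Real.Gamma w * z ^ (-(w : ℂ))) {z : ℂ | 0 < z.re} := by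
    refine DifferentiableOn.analyticOnNhd (fun z hz ↦ ?_) hopen
    refine (DifferentiableAt.const_mul ?_ _).differentiableWithinAt
    exact differentiableAt_id.cpow_const (Or.inl hz)
  have hreal : ∀ x : ℝ, 0 < x →
      complexMGF id ν (-(x : ℂ)) = Real.Gamma w * (x : ℂ) ^ (-(w : ℂ)) := by
    intro x hx
    have h := Real.integral_rpow_mul_exp_neg_mul_Ioi hw hx
    rw [hint, ← Complex.ofReal_neg w, ← Complex.ofReal_cpow hx.le, ← Complex.ofReal_mul,
      Real.rpow_neg hx.le, ← Real.inv_rpow hx.le, ← one_div, mul_comm (Real.Gamma w),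
      ← h, ← integral_complex_ofReal]
    refine integral_congr_ae (Eventually.of_forall fun t ↦ ?_)
    simp
  have hfreq : ∃ᶠ z in 𝓝[≠] (1 : ℂ),
      complexMGF id ν (-z) = Real.Gamma w * z ^ (-(w : ℂ)) := by
    have htend : Tendsto (fun x : ℝ ↦ (x : ℂ)) (𝓝[≠] 1) (𝓝[≠] 1) := by
      refine tendsto_nhdsWithin_iff.2 ⟨?_, ?_⟩
      · exact (Complex.continuous_ofReal.tendsto' 1 1 (by simp)).mono_left nhdsWithin_le_nhds
      · filter_upwards [self_mem_nhdsWithin] with x hx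
        simpa using hx
    refine htend.frequently (Eventually.frequently ?_)
    filter_upwards [nhdsWithin_le_nhds (Ioi_mem_nhds one_pos)] with x hx using hreal x hx
  rw [← hint]
  exact hf.eqOn_of_preconnected_of_frequently_eq hg
    (convex_halfSpace_re_gt 0).isPreconnected (by simp : (1 : ℂ) ∈ {z : ℂ | 0 < z.re}) hfreq hz

lemma one_add_abs_le_two_mul_norm {a : ℝ} (ha : 1 ≤ a) (u : ℝ) :
    1 + |u| ≤ 2 * ‖(a + u * I : ℂ)‖ := by
  have h1 := Complex.abs_re_le_norm (a + u * I : ℂ)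
  have h2 := Complex.abs_im_le_norm (a + u * I : ℂ)
  simp only [add_re, ofReal_re, mul_re, I_re, mul_zero, ofReal_im, I_im, mul_one, sub_self,
    add_zero, add_im, mul_im, zero_add] at h1 h2
  linarith [le_abs_self a]

lemma norm_verticalLine_rpow_neg_le {a p : ℝ} (ha : 1 ≤ a) (hp : 0 ≤ p) (u : ℝ) :
    ‖(a + u * I : ℂ)‖ ^ (-p) ≤ 2 ^ p * (1 + |u|) ^ (-p) := by
  have h := one_add_abs_le_two_mul_norm ha u
  have h0 : 0 < 1 + |u| := by positivity
  have : ‖(a + u * I : ℂ)‖ ^ (-p) ≤ ((1 + |u|) / 2) ^ (-p) :=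
    Real.rpow_le_rpow_of_nonpos (by positivity) (by linarith) (by linarith)
  refine this.trans_eq ?_
  rw [Real.div_rpow h0.le (by norm_num), Real.rpow_neg (by norm_num : (0 : ℝ) ≤ 2)]
  field_simp

lemma continuous_verticalLine_cpow {a : ℝ} (ha : 0 < a) (c : ℂ) :
    Continuous fun u : ℝ ↦ (a + u * I : ℂ) ^ c :=
  Continuous.cpow (by fun_prop) continuous_const fun u ↦ Or.inl (by simpa using ha)

lemma integrable_norm_verticalLine_rpow_neg {a p : ℝ} (ha : 1 ≤ a) (hp : 1 < p) :
    Integrable fun u : ℝ ↦ ‖(a + u * I : ℂ)‖ ^ (-p) := by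
  have hJ : Integrable fun u : ℝ ↦ (1 + |u|) ^ (-p) := by
    simpa using integrable_one_add_norm (E := ℝ) (μ := volume) (r := p) (by simpa using hp)
  refine (hJ.const_mul (2 ^ p)).mono'
    (Measurable.pow_const (by fun_prop) _).aestronglyMeasurable ?_
  refine Eventually.of_forall fun u ↦ ?_
  rw [Real.norm_of_nonneg (by positivity)]
  exact norm_verticalLine_rpow_neg_le ha (by linarith) u

/-- The Laplace integral for the reciprocal Gamma function along a vertical line. -/
lemma integral_verticalLine_cexp_mul_cpow_neg {w a : ℝ} (hw : 1 < w) (ha : 1 ≤ a) :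
    ∫ u : ℝ, cexp (a + u * I) * (a + u * I : ℂ) ^ (-(w : ℂ)) = 2 * Real.pi / Real.Gamma w := by
  have ha0 : 0 < a := by linarith
  have hG : (Real.Gamma w : ℂ) ≠ 0 := by exact_mod_cast (Real.Gamma_pos_of_pos (by linarith)).ne'
  let f : ℝ → ℂ := indicator (Ioi 0) fun x ↦ ((x ^ (w - 1) : ℝ) : ℂ) * cexp (-a * x)
  have hf : Integrable f := by
    rw [integrable_indicator_iff measurableSet_Ioi]
    have h := (integrableOn_rpow_mul_exp_neg_mul (w := w) (by linarith) ha0).ofReal (𝕜 := ℂ)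
    refine h.congr (Eventually.of_forall fun x ↦ ?_)
    simp
  have hF : 𝓕 f = fun v : ℝ ↦
      Real.Gamma w * (a + (2 * Real.pi * v : ℝ) * I : ℂ) ^ (-(w : ℂ)) := by
    ext v
    rw [← integral_rpow_mul_cexp_neg_mul_Ioi (by linarith) (by simpa using ha0),
      Real.fourier_real_eq_integral_exp_smul, ← integral_indicator measurableSet_Ioi]
    congr 1
    ext x
    by_cases hx : x ∈ Ioi (0 : ℝ)
    · simp only [f, indicator_of_mem hx, smul_eq_mul]
      rw [mul_left_comm, ← Complex.exp_add]
      congr 2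
      push_cast
      ring
    · simp [f, indicator_of_notMem hx]
  have hlineint : Integrable fun u : ℝ ↦ (a + u * I : ℂ) ^ (-(w : ℂ)) := by
    refine (integrable_norm_verticalLine_rpow_neg ha hw).mono'
      (continuous_verticalLine_cpow ha0 _).aestronglyMeasurable (Eventually.of_forall fun u ↦ ?_)
    rw [← ofReal_neg, norm_cpow_real]
  have hFint : Integrable (𝓕 f) := by
    rw [hF]
    exact (hlineint.comp_mul_left' (R := 2 * Real.pi) (by positivity)).const_mul _
  have hcont : ContinuousAt f 1 := by
    have : ContinuousAt (fun x : ℝ ↦ ((x ^ (w - 1) : ℝ) : ℂ) * cexp (-a * x)) 1 := by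
      refine ContinuousAt.mul ?_ (by fun_prop)
      exact Complex.continuous_ofReal.continuousAt.comp
        (Real.continuousAt_rpow_const _ _ (Or.inl one_ne_zero))
    refine this.congr ?_
    filter_upwards [Ioi_mem_nhds (one_pos : (0 : ℝ) < 1)] with x hx
    simp only [f, indicator_of_mem (show x ∈ Ioi 0 from hx)]
  have hinv := hf.fourierInv_fourier_eq hFint hcont
  rw [Real.fourierInv_eq', hF] at hinv
  have hscale := Measure.integral_comp_mul_left
    (fun u : ℝ ↦ cexp (a + u * I) * (a + u * I : ℂ) ^ (-(w : ℂ))) (2 * Real.pi)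
  have hpi : (0 : ℝ) < 2 * Real.pi := by positivity
  have hval : ∫ v : ℝ, cexp (a + (2 * Real.pi * v : ℝ) * I) *
      (a + (2 * Real.pi * v : ℝ) * I : ℂ) ^ (-(w : ℂ)) = 1 / Real.Gamma w := by
    have hf1 : f 1 = cexp (-a) := by simp [f]
    have : ∀ v : ℝ, cexp (a + (2 * Real.pi * v : ℝ) * I) *
      (a + (2 * Real.pi * v : ℝ) * I : ℂ) ^ (-(w : ℂ)) = (cexp a / Real.Gamma w) *
        (cexp (↑(2 * Real.pi * inner ℝ v 1) * I) •
          (Real.Gamma w * (a + (2 * Real.pi * v : ℝ) * I : ℂ) ^ (-(w : ℂ)))) := by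
      intro v
      rw [Complex.exp_add]
      simp only [RCLike.inner_apply, conj_trivial, one_mul, smul_eq_mul]
      field_simp
    simp_rw [this]
    rw [integral_const_mul, hinv, hf1, div_mul_eq_mul_div, ← Complex.exp_add]
    simp
  rw [hval, abs_of_pos (inv_pos.2 hpi)] at hscale
  rw [Complex.real_smul] at hscale
  have hpi' : (Real.pi : ℂ) ≠ 0 := by exact_mod_cast Real.pi_ne_zero
  push_cast at hscale
  field_simp at hscale
  rw [eq_div_iff hG, hscale, mul_comm]

/-- Shifting a vertical line of integration for a function holomorphic on the right half-plane
that decays integrably on a vertical strip. -/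
lemma integral_verticalLine_eq_of_norm_le {f : ℂ → ℂ} {a b C p : ℝ} (ha : 1 ≤ a) (hab : a ≤ b)
    (hp : 1 < p) (hf : DifferentiableOn ℂ f {s | 0 < s.re})
    (hbound : ∀ s : ℂ, a ≤ s.re → s.re ≤ b → ‖f s‖ ≤ C * ‖s‖ ^ (-p)) :
    ∫ u : ℝ, f (a + u * I) = ∫ u : ℝ, f (b + u * I) := by
  have hint : ∀ c : ℝ, a ≤ c → c ≤ b → Integrable fun u : ℝ ↦ f (c + u * I) := by
    intro c hac hcb
    have hcont : Continuous fun u : ℝ ↦ f (c + u * I) :=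
      hf.continuousOn.comp_continuous (by fun_prop) fun u ↦ by
        simp only [Set.mem_ofPred_eq, add_re, ofReal_re, mul_re, I_re, ofReal_im, I_im]
        linarith
    refine ((integrable_norm_verticalLine_rpow_neg (ha.trans hac) hp).const_mul C).mono'
      hcont.aestronglyMeasurable (Eventually.of_forall fun u ↦ ?_)
    exact hbound _ (by simpa using hac) (by simpa using hcb)
  have hlim : ∀ c : ℝ, a ≤ c → c ≤ b →
      Tendsto (fun T : ℝ ↦ ∫ u in -T..T, f (c + u * I)) atTop (𝓝 (∫ u : ℝ, f (c + u * I))) :=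
    fun c hac hcb ↦ intervalIntegral_tendsto_integral (hint c hac hcb)
      tendsto_neg_atTop_atBot tendsto_id
  have hC : 0 ≤ C := by
    have h := (norm_nonneg _).trans (hbound a (by simp) (by simpa using hab))
    have ha' : 0 < ‖(a : ℂ)‖ ^ (-p) := by
      apply Real.rpow_pos_of_pos
      simp only [norm_real, Real.norm_eq_abs]
      positivity
    exact nonneg_of_mul_nonneg_left h ha'
  have hhor : ∀ σ : ℝ, |σ| = 1 →
      Tendsto (fun T : ℝ ↦ ∫ x in a..b, f (x + (σ * T : ℝ) * I)) atTop (𝓝 0) := by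
    intro σ hσ
    have hz : Tendsto (fun T : ℝ ↦ C * T ^ (-p) * |b - a|) atTop (𝓝 0) := by
      simpa using ((tendsto_rpow_neg_atTop (by linarith : 0 < p)).const_mul C).mul_const |b - a|
    refine squeeze_zero_norm' ?_ hz
    filter_upwards [eventually_gt_atTop 0] with T hT
    refine intervalIntegral.norm_integral_le_of_norm_le_const fun x hx ↦ ?_
    rw [uIoc_of_le hab] at hx
    refine (hbound _ (by simpa using hx.1.le) (by simpa using hx.2)).trans ?_
    refine mul_le_mul_of_nonneg_left (Real.rpow_le_rpow_of_nonpos hT ?_ (by linarith)) hC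
    refine le_trans ?_ (Complex.abs_im_le_norm _)
    simp [abs_mul, hσ, le_abs_self]
  have hrect : ∀ T : ℝ, (∫ u in -T..T, f (b + u * I)) - (∫ u in -T..T, f (a + u * I)) =
      I * ((∫ x in a..b, f (x + ((-1) * T : ℝ) * I)) - ∫ x in a..b, f (x + (1 * T : ℝ) * I)) := by
    intro T
    have h := integral_boundary_rect_eq_zero_of_differentiableOn f
      (a + (-T : ℝ) * I) (b + T * I) (hf.mono ?_)
    · simp only [add_re, ofReal_re, mul_re, I_re, mul_zero, ofReal_im, I_im, mul_one, sub_self,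
        add_zero, add_im, mul_im, zero_add, smul_eq_mul] at h
      simp only [neg_one_mul, one_mul]
      linear_combination (-I) * h + ((∫ u in -T..T, f (b + u * I)) -
        (∫ u in -T..T, f (a + u * I))) * I_sq
    · intro s hs
      have := hs.1
      simp only [add_re, ofReal_re, mul_re, I_re, mul_zero, ofReal_im, I_im, mul_one, sub_self,
        add_zero, mem_preimage, uIcc_of_le hab] at this
      exact lt_of_lt_of_le (by linarith) this.1
  have h1 := (hlim b hab le_rfl).sub (hlim a le_rfl hab)
  have h2 := ((hhor (-1) (by simp)).sub (hhor 1 (by simp))).const_mul I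
  simp_rw [hrect] at h1
  have h3 := tendsto_nhds_unique h1 h2
  simp only [sub_zero, mul_zero] at h3
  exact (sub_eq_zero.1 h3).symm

/-- The integrand of the vertical-line integral representation of `E_{α,β}(z)`. -/
noncomputable def mittagLefflerKernel (α β : ℝ) (z s : ℂ) : ℂ :=
  cexp s * s ^ (-((β + 1 : ℝ) : ℂ)) *
    ((β - α) * (1 - z * s ^ (-(α : ℂ)))⁻¹ + α * ((1 - z * s ^ (-(α : ℂ)))⁻¹) ^ 2)

/-- The representation of `E_{α,β}(z)` on a vertical line far to the right. -/
lemma mittagLeffler_eq_integral_of_lt {α β a : ℝ} {z : ℂ} (hα : 0 < α) (hβ : 0 < β) (ha : 1 ≤ a)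
    (hz : ‖z‖ < a ^ α) :
    mittagLeffler α β z = 1 / (2 * Real.pi) * ∫ u : ℝ, mittagLefflerKernel α β z (a + u * I) := by
  have ha0 : 0 < a := by linarith
  have hpi' : (Real.pi : ℂ) ≠ 0 := by exact_mod_cast Real.pi_ne_zero
  let F : ℕ → ℝ → ℂ := fun k u ↦ z ^ k * ((β + k * α : ℝ) : ℂ) *
    (cexp (a + u * I) * (a + u * I : ℂ) ^ (-((k * α + β + 1 : ℝ) : ℂ)))
  have hnorm : ∀ u : ℝ, a ≤ ‖(a + u * I : ℂ)‖ := fun u ↦ by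
    simpa [abs_of_pos ha0] using Complex.abs_re_le_norm (a + u * I : ℂ)
  have hne : ∀ u : ℝ, (a + u * I : ℂ) ≠ 0 := fun u h ↦ by
    have := hnorm u
    rw [h, norm_zero] at this
    linarith
  set q : ℝ := ‖z‖ * a ^ (-α) with hq
  have hq0 : 0 ≤ q := by positivity
  have hq1 : q < 1 := by
    rw [hq, Real.rpow_neg ha0.le, ← div_eq_mul_inv, div_lt_one (by positivity)]
    exact hz
  have hsplit : ∀ (k : ℕ) (u : ℝ), (a + u * I : ℂ) ^ (-((k * α + β + 1 : ℝ) : ℂ)) =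
      (a + u * I : ℂ) ^ (-((β + 1 : ℝ) : ℂ)) * ((a + u * I : ℂ) ^ (-(α : ℂ))) ^ k := by
    intro k u
    rw [← cpow_nat_mul, ← cpow_add _ _ (hne u)]
    congr 1
    push_cast
    ring
  have hx : ∀ u : ℝ, ‖z * (a + u * I : ℂ) ^ (-(α : ℂ))‖ ≤ q := by
    intro u
    rw [norm_mul, ← ofReal_neg, norm_cpow_real]
    exact mul_le_mul_of_nonneg_left
      (Real.rpow_le_rpow_of_nonpos ha0 (hnorm u) (by linarith)) (norm_nonneg _)
  have hFnorm : ∀ k u, ‖F k u‖ ≤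
      (Real.exp a * ((β + k * α) * q ^ k)) * ‖(a + u * I : ℂ)‖ ^ (-(β + 1)) := by
    intro k u
    have hk : 0 ≤ β + k * α := by positivity
    have h1 : ‖F k u‖ = Real.exp a * ((β + k * α) * ‖z * (a + u * I : ℂ) ^ (-(α : ℂ))‖ ^ k) *
        ‖(a + u * I : ℂ)‖ ^ (-(β + 1)) := by
      simp only [F]
      rw [hsplit, norm_mul, norm_mul, norm_mul, norm_mul, ← ofReal_neg (β + 1), norm_cpow_real,
        Complex.norm_exp, norm_real, Real.norm_of_nonneg hk, norm_pow, norm_pow, norm_mul, mul_pow]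
      simp only [add_re, ofReal_re, mul_re, I_re, mul_zero, ofReal_im, I_im, mul_one, sub_self,
        add_zero]
      ring
    rw [h1]
    gcongr
    exact hx u
  have hFcont : ∀ k, Continuous (F k) := fun k ↦
    continuous_const.mul (Continuous.mul (by fun_prop) (continuous_verticalLine_cpow ha0 _))
  have hJ := integrable_norm_verticalLine_rpow_neg ha (by linarith : 1 < β + 1)
  have hFint : ∀ k, Integrable (F k) := fun k ↦
    (hJ.const_mul _).mono' (hFcont k).aestronglyMeasurable (Eventually.of_forall (hFnorm k))
  have hsum : Summable fun k ↦ ∫ u, ‖F k u‖ := by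
    have hq' : ‖q‖ < 1 := by rwa [Real.norm_of_nonneg hq0]
    have h1 : Summable fun k : ℕ ↦ (Real.exp a * ((β + k * α) * q ^ k)) *
        ∫ u : ℝ, ‖(a + u * I : ℂ)‖ ^ (-(β + 1)) := by
      refine (Summable.mul_left _ ?_).mul_right _
      have h2 := ((hasSum_geometric_of_norm_lt_one hq').summable.mul_left β).add
        ((hasSum_coe_mul_geometric_of_norm_lt_one hq').summable.mul_left α)
      exact h2.congr fun k ↦ by ring
    refine Summable.of_nonneg_of_le (fun k ↦ integral_nonneg fun u ↦ norm_nonneg _) (fun k ↦ ?_) h1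
    rw [← integral_const_mul]
    exact integral_mono (hFint k).norm (hJ.const_mul _) (hFnorm k)
  have hmain := hasSum_integral_of_summable_integral_norm hFint hsum
  have hterm : ∀ k : ℕ, ∫ u, F k u = (2 * Real.pi) * (z ^ k / Real.Gamma (k * α + β)) := by
    intro k
    have hk : 0 < k * α + β := by positivity
    simp only [F]
    rw [integral_const_mul, integral_verticalLine_cexp_mul_cpow_neg (by linarith) ha,
      Real.Gamma_add_one hk.ne']
    have hk' : ((k * α + β : ℝ) : ℂ) ≠ 0 := by exact_mod_cast hk.ne'
    have hG : (Real.Gamma (k * α + β) : ℂ) ≠ 0 := by exact_mod_cast (Real.Gamma_pos_of_pos hk).ne'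
    rw [add_comm β, ofReal_mul]
    field_simp
  have hkernel : ∀ u : ℝ, ∑' k, F k u = mittagLefflerKernel α β z (a + u * I) := by
    intro u
    have hx1 : ‖z * (a + u * I : ℂ) ^ (-(α : ℂ))‖ < 1 := (hx u).trans_lt hq1
    have h1 := ((hasSum_geometric_of_norm_lt_one hx1).mul_left (β : ℂ)).add
      ((hasSum_coe_mul_geometric_of_norm_lt_one hx1).mul_left (α : ℂ))
    have h2 := h1.mul_left (cexp (a + u * I) * (a + u * I : ℂ) ^ (-((β + 1 : ℝ) : ℂ)))
    have hne1 : (1 : ℂ) - z * (a + u * I : ℂ) ^ (-(α : ℂ)) ≠ 0 := by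
      intro h
      rw [← sub_eq_zero.1 h] at hx1
      simp at hx1
    have h3 : mittagLefflerKernel α β z (a + u * I) =
        cexp (a + u * I) * (a + u * I : ℂ) ^ (-((β + 1 : ℝ) : ℂ)) *
        (β * (1 - z * (a + u * I : ℂ) ^ (-(α : ℂ)))⁻¹ + α * (z * (a + u * I : ℂ) ^ (-(α : ℂ)) /
          (1 - z * (a + u * I : ℂ) ^ (-(α : ℂ))) ^ 2)) := by
      simp only [mittagLefflerKernel]
      congr 1
      field_simp
      ring
    rw [h3, ← h2.tsum_eq]
    refine tsum_congr fun k ↦ ?_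
    simp only [F]
    rw [hsplit, mul_pow]
    push_cast
    ring
  simp_rw [hterm, hkernel] at hmain
  have h4 := hmain.mul_left (1 / (2 * Real.pi : ℂ))
  rw [mittagLeffler, ← h4.tsum_eq]
  refine tsum_congr fun k ↦ ?_
  field_simp

lemma cos_mul_norm_rpow_le_re_cpow {α : ℝ} (h0 : 0 < α) (h1 : α < 1) {s : ℂ} (hs : 0 < s.re) :
    Real.cos (α * (Real.pi / 2)) * ‖s‖ ^ α ≤ (s ^ (α : ℂ)).re := by
  rw [cpow_ofReal_re, mul_comm]
  have harg : |s.arg| < Real.pi / 2 := abs_arg_lt_pi_div_two_iff.2 (Or.inl hs)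
  refine mul_le_mul_of_nonneg_left ?_ (by positivity)
  rw [← Real.cos_abs (s.arg * α), abs_mul, abs_of_pos h0, mul_comm]
  refine Real.cos_le_cos_of_nonneg_of_le_pi (by positivity) ?_ (by gcongr)
  nlinarith [Real.pi_pos]

/-- For imaginary `z`, the symbol `1 - z s^{-α}` does not vanish on the right half-plane, and its
inverse is controlled uniformly. -/
lemma exists_norm_inv_one_sub_le {α : ℝ} (h0 : 0 < α) (h1 : α < 1) :
    ∃ K > 0, ∀ (r : ℝ) (s : ℂ), 0 < s.re → 1 - I * r * s ^ (-(α : ℂ)) ≠ 0 ∧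
      ‖(1 - I * r * s ^ (-(α : ℂ)))⁻¹‖ ≤ K * (‖s‖ ^ α / (‖s‖ ^ α + |r|)) := by
  have hc : 0 < Real.cos (α * (Real.pi / 2)) :=
    Real.cos_pos_of_mem_Ioo ⟨by nlinarith [Real.pi_pos], by nlinarith [Real.pi_pos]⟩
  set c := Real.cos (α * (Real.pi / 2))
  refine ⟨1 + 2 / c, by positivity, fun r s hs ↦ ?_⟩
  have hs0 : s ≠ 0 := fun h ↦ by simp [h] at hs
  have hy0 : s ^ (α : ℂ) ≠ 0 := by simp [cpow_eq_zero_iff, hs0]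
  have hnorm : ‖s ^ (α : ℂ)‖ = ‖s‖ ^ α := norm_cpow_real s α
  have hspos : 0 < ‖s‖ ^ α := Real.rpow_pos_of_pos (norm_pos_iff.2 hs0) α
  have heq : 1 - I * r * s ^ (-(α : ℂ)) = (s ^ (α : ℂ) - I * r) / s ^ (α : ℂ) := by
    rw [cpow_neg]
    field_simp
  have hlow : c * ‖s‖ ^ α ≤ ‖s ^ (α : ℂ) - I * r‖ := by
    refine (cos_mul_norm_rpow_le_re_cpow h0 h1 hs).trans ?_
    refine le_trans ?_ (Complex.re_le_norm _)
    simp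
  have hpos : 0 < ‖s ^ (α : ℂ) - I * r‖ := lt_of_lt_of_le (by positivity) hlow
  have hr : |r| ≤ ‖s ^ (α : ℂ) - I * r‖ + ‖s‖ ^ α := by
    have h := norm_sub_le (s ^ (α : ℂ)) (s ^ (α : ℂ) - I * r)
    rw [sub_sub_cancel, hnorm, norm_mul, norm_I, one_mul, norm_real, Real.norm_eq_abs] at h
    linarith
  have hsle : ‖s‖ ^ α ≤ ‖s ^ (α : ℂ) - I * r‖ / c := by
    rw [le_div_iff₀ hc]
    linarith
  rw [heq]
  refine ⟨div_ne_zero (norm_pos_iff.1 hpos) hy0, ?_⟩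
  rw [inv_div, norm_div, hnorm, mul_div_assoc', div_le_div_iff₀ hpos (by positivity),
    mul_comm (1 + 2 / c), mul_assoc]
  refine mul_le_mul_of_nonneg_left ?_ hspos.le
  have : (1 + 2 / c) * ‖s ^ (α : ℂ) - I * r‖ =
      ‖s ^ (α : ℂ) - I * r‖ + 2 * (‖s ^ (α : ℂ) - I * r‖ / c) := by ring
  linarith

lemma norm_mittagLefflerKernel_le {α β K r : ℝ} (h0 : 0 < α) {s : ℂ}
    (hK : ‖(1 - I * r * s ^ (-(α : ℂ)))⁻¹‖ ≤ K * (‖s‖ ^ α / (‖s‖ ^ α + |r|))) :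
    ‖mittagLefflerKernel α β (I * r) s‖ ≤ Real.exp s.re * ‖s‖ ^ (-(β + 1)) *
      (|β - α| * (K * (‖s‖ ^ α / (‖s‖ ^ α + |r|))) +
        α * (K * (‖s‖ ^ α / (‖s‖ ^ α + |r|))) ^ 2) := by
  rw [mittagLefflerKernel, norm_mul, norm_mul, ← ofReal_neg (β + 1), norm_cpow_real,
    Complex.norm_exp]
  refine mul_le_mul_of_nonneg_left ((norm_add_le _ _).trans ?_) (by positivity)
  rw [norm_mul, norm_mul, norm_pow, ← ofReal_sub, norm_real, norm_real, Real.norm_eq_abs,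
    Real.norm_of_nonneg h0.le]
  gcongr

/-- The representation of `E_{α,β}` on the imaginary axis by an integral over `Re s = 1`. -/
lemma mittagLeffler_I_mul_eq_integral {α β : ℝ} (h0 : 0 < α) (h1 : α < 1) (hβ : 0 < β) (r : ℝ) :
    mittagLeffler α β (I * r) =
      1 / (2 * Real.pi) * ∫ u : ℝ, mittagLefflerKernel α β (I * r) ((1 : ℝ) + u * I) := by
  obtain ⟨K, hK0, hK⟩ := exists_norm_inv_one_sub_le h0 h1
  obtain ⟨b, hb1, hbr⟩ : ∃ b : ℝ, 1 ≤ b ∧ |r| < b ^ α :=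
    ((eventually_ge_atTop 1).and ((tendsto_rpow_atTop h0).eventually_gt_atTop |r|)).exists
  rw [mittagLeffler_eq_integral_of_lt h0 hβ hb1 (by simpa using hbr)]
  congr 1
  symm
  refine integral_verticalLine_eq_of_norm_le (C := Real.exp b * (|β - α| * K + α * K ^ 2))
    (p := β + 1) le_rfl hb1 (by linarith) (fun s hs ↦ ?_) fun s hs hsb ↦ ?_
  · have hcpow : ∀ c : ℂ, DifferentiableAt ℂ (fun s : ℂ ↦ s ^ c) s := fun c ↦
      differentiableAt_id.cpow_const (Or.inl hs)
    have hinv : DifferentiableAt ℂ (fun s : ℂ ↦ (1 - I * r * s ^ (-(α : ℂ)))⁻¹) s :=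
      (((hcpow _).const_mul _).const_sub 1).inv (hK r s hs).1
    refine DifferentiableAt.differentiableWithinAt ?_
    exact (differentiableAt_exp.mul (hcpow _)).mul
      ((hinv.const_mul _).add ((hinv.pow 2).const_mul _))
  · have hs0 : 0 < s.re := by linarith
    have hq : ‖s‖ ^ α / (‖s‖ ^ α + |r|) ≤ 1 :=
      div_le_one_of_le₀ (by linarith [abs_nonneg r]) (by positivity)
    refine (norm_mittagLefflerKernel_le h0 (hK r s hs0).2).trans ?_
    rw [mul_right_comm]
    gcongr
    · exact mul_le_of_le_one_right hK0.le hq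
    · exact mul_le_of_le_one_right hK0.le hq

lemma integrable_comp_abs_of_integrableOn_Ioi {g : ℝ → ℝ} (hg : IntegrableOn g (Ioi 0)) :
    Integrable fun u : ℝ ↦ g |u| := by
  have h1 : Integrable (indicator (Ioi 0) g) := (integrable_indicator_iff measurableSet_Ioi).2 hg
  refine (h1.add h1.comp_neg).congr ?_
  have h0 : ∀ᵐ u : ℝ, u ≠ 0 := by simp [ae_iff, measure_singleton]
  filter_upwards [h0] with u hu
  rcases lt_or_gt_of_ne hu with h | h
  · simp [indicator, h, abs_of_neg h, not_lt.2 h.le]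
  · simp [indicator, h, abs_of_pos h, not_lt.2 h.le]

lemma integrableOn_and_integral_Ioi_rpow_div_sq {α R : ℝ} (h0 : 0 < α) (hR : 0 < R) :
    IntegrableOn (fun u : ℝ ↦ u ^ (α - 1) / (u ^ α + R) ^ 2) (Ioi 0) ∧
      ∫ u in Ioi (0 : ℝ), u ^ (α - 1) / (u ^ α + R) ^ 2 = 1 / (α * R) := by
  have hcont : ContinuousWithinAt (fun u : ℝ ↦ -(α * (u ^ α + R))⁻¹) (Ici 0) 0 := by
    refine ContinuousAt.continuousWithinAt ?_
    refine (ContinuousAt.inv₀ ?_ ?_).neg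
    · exact continuousAt_const.mul
        ((Real.continuousAt_rpow_const _ _ (Or.inr h0.le)).add continuousAt_const)
    · rw [Real.zero_rpow h0.ne', zero_add]
      positivity
  have hderiv : ∀ u ∈ Ioi (0 : ℝ), HasDerivAt (fun u : ℝ ↦ -(α * (u ^ α + R))⁻¹)
      (u ^ (α - 1) / (u ^ α + R) ^ 2) u := by
    intro u hu
    have hu : 0 < u := hu
    have hne : α * (u ^ α + R) ≠ 0 := by positivity
    have hne' : u ^ α + R ≠ 0 := by positivity
    have h := ((((Real.hasDerivAt_rpow_const (x := u) (p := α) (Or.inl hu.ne')).add_const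
      R).const_mul α).inv hne).neg
    refine h.congr_deriv ?_
    field_simp
  have hpos : ∀ u ∈ Ioi (0 : ℝ), 0 ≤ u ^ (α - 1) / (u ^ α + R) ^ 2 := by
    intro u hu
    have hu : 0 < u := hu
    positivity
  have hlim : Tendsto (fun u : ℝ ↦ -(α * (u ^ α + R))⁻¹) atTop (𝓝 0) := by
    have h := (tendsto_atTop_add_const_right atTop R (tendsto_rpow_atTop h0)).const_mul_atTop h0
    simpa using h.inv_tendsto_atTop.neg
  refine ⟨integrableOn_Ioi_deriv_of_nonneg hcont hderiv hpos hlim, ?_⟩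
  rw [integral_Ioi_of_hasDerivAt_of_nonneg hcont hderiv hpos hlim]
  simp [Real.zero_rpow h0.ne']

lemma norm_mittagLeffler_I_mul_le {α β r B : ℝ} (h0 : 0 < α) (h1 : α < 1) (hβ : 0 < β)
    {g : ℝ → ℝ} (hg : Integrable g) (hgB : ∫ u, g u ≤ B)
    (hbound : ∀ᵐ u : ℝ, ‖mittagLefflerKernel α β (I * r) ((1 : ℝ) + u * I)‖ ≤ g u) :
    ‖mittagLeffler α β (I * r)‖ ≤ B := by
  rw [mittagLeffler_I_mul_eq_integral h0 h1 hβ, norm_mul]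
  have h := (norm_integral_le_of_norm_le hg hbound).trans hgB
  have hc : ‖(1 / (2 * Real.pi) : ℂ)‖ ≤ 1 := by
    rw [norm_div, norm_mul, norm_real, Real.norm_of_nonneg Real.pi_pos.le]
    simp only [norm_one, Complex.norm_ofNat]
    rw [div_le_one (by positivity)]
    linarith [Real.two_le_pi]
  exact (mul_le_of_le_one_left (norm_nonneg _) hc).trans h

lemma one_le_norm_one_add_mul_I (u : ℝ) : 1 ≤ ‖((1 : ℝ) + u * I : ℂ)‖ := by
  simpa using Complex.abs_re_le_norm ((1 : ℝ) + u * I : ℂ)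

lemma exists_norm_mittagLeffler_one_le {α : ℝ} (h0 : 0 < α) (h1 : α < 1) :
    ∃ C > 0, ∀ r : ℝ, ‖mittagLeffler α 1 (I * r)‖ ≤ C / (1 + |r|) := by
  obtain ⟨K, hK0, hK⟩ := exists_norm_inv_one_sub_le h0 h1
  set J := ∫ u : ℝ, ‖((1 : ℝ) + u * I : ℂ)‖ ^ (-(2 - α)) with hJ
  have hJ0 : 0 ≤ J := integral_nonneg fun u ↦ by positivity
  have hM : 0 < Real.exp 1 * ((1 - α) * K + α * K ^ 2) * 2 := by
    have : 0 < 1 - α := by linarith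
    positivity
  set M := Real.exp 1 * ((1 - α) * K + α * K ^ 2) * 2 with hMdef
  refine ⟨M * (J + 1), by positivity, fun r ↦ ?_⟩
  have hr : 0 < 1 + |r| := by positivity
  refine norm_mittagLeffler_I_mul_le h0 h1 one_pos
    ((integrable_norm_verticalLine_rpow_neg (p := 2 - α) le_rfl (by linarith)).const_mul
      (M / (1 + |r|))) ?_ (Eventually.of_forall fun u ↦ ?_)
  · rw [integral_const_mul, ← hJ, div_mul_eq_mul_div]
    gcongr
    linarith
  · have hs1 := one_le_norm_one_add_mul_I u
    set s : ℂ := (1 : ℝ) + u * I with hs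
    have hre : s.re = 1 := by simp [hs]
    have hs0 : 0 < ‖s‖ := by linarith
    have hsα : 1 ≤ ‖s‖ ^ α := Real.one_le_rpow hs1 h0.le
    have ht1 : ‖s‖ ^ α / (‖s‖ ^ α + |r|) ≤ 1 :=
      div_le_one_of_le₀ (by linarith [abs_nonneg r]) (by positivity)
    have ht0 : 0 ≤ ‖s‖ ^ α / (‖s‖ ^ α + |r|) := by positivity
    have ht2 : ‖s‖ ^ α / (‖s‖ ^ α + |r|) ≤ 2 * ‖s‖ ^ α / (1 + |r|) := by
      rw [div_le_div_iff₀ (by positivity) hr]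
      have : 1 + |r| ≤ 2 * (‖s‖ ^ α + |r|) := by linarith [abs_nonneg r]
      nlinarith
    have h := norm_mittagLefflerKernel_le (β := 1) h0 (hK r s (by simp [hre])).2
    rw [hre, abs_of_pos (by linarith : 0 < 1 - α)] at h
    set t := ‖s‖ ^ α / (‖s‖ ^ α + |r|)
    have h1' : 0 ≤ 1 - α := by linarith
    calc _ ≤ _ := h
      _ = Real.exp 1 * ‖s‖ ^ (-(1 + 1) : ℝ) * ((1 - α) * K * t + α * K ^ 2 * (t * t)) := by ring
      _ ≤ Real.exp 1 * ‖s‖ ^ (-(1 + 1) : ℝ) * ((1 - α) * K * t + α * K ^ 2 * t) := by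
        gcongr
        exact mul_le_of_le_one_left ht0 ht1
      _ = Real.exp 1 * ‖s‖ ^ (-(1 + 1) : ℝ) * ((1 - α) * K + α * K ^ 2) * t := by ring
      _ ≤ Real.exp 1 * ‖s‖ ^ (-(1 + 1) : ℝ) * ((1 - α) * K + α * K ^ 2) *
          (2 * ‖s‖ ^ α / (1 + |r|)) := by gcongr
      _ = M / (1 + |r|) * (‖s‖ ^ (-(1 + 1) : ℝ) * ‖s‖ ^ α) := by
        rw [hMdef]
        ring
      _ = M / (1 + |r|) * ‖s‖ ^ (-(2 - α)) := by
        rw [← Real.rpow_add hs0]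
        congr 2
        ring

lemma exists_norm_mittagLeffler_self_le {α : ℝ} (h0 : 0 < α) (h1 : α < 1) :
    ∃ C > 0, ∀ r : ℝ, ‖mittagLeffler α α (I * r)‖ ≤ C / (1 + |r|) := by
  obtain ⟨K, hK0, hK⟩ := exists_norm_inv_one_sub_le h0 h1
  refine ⟨Real.exp 1 * α * K ^ 2 * 4 * (2 * (1 / α)), by positivity, fun r ↦ ?_⟩
  have hr : 0 < 1 + |r| := by positivity
  obtain ⟨hint, hval⟩ := integrableOn_and_integral_Ioi_rpow_div_sq h0 hr
  refine norm_mittagLeffler_I_mul_le h0 h1 h0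
    ((integrable_comp_abs_of_integrableOn_Ioi hint).const_mul (Real.exp 1 * α * K ^ 2 * 4)) ?_ ?_
  · rw [integral_const_mul,
      integral_comp_abs (f := fun u : ℝ ↦ u ^ (α - 1) / (u ^ α + (1 + |r|)) ^ 2), hval]
    apply le_of_eq
    field_simp
  · have hne : ∀ᵐ u : ℝ, u ≠ 0 := by simp [ae_iff, measure_singleton]
    filter_upwards [hne] with u hu
    have hs1 := one_le_norm_one_add_mul_I u
    have hsu : |u| ≤ ‖((1 : ℝ) + u * I : ℂ)‖ := by
      simpa using Complex.abs_im_le_norm ((1 : ℝ) + u * I : ℂ)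
    set s : ℂ := (1 : ℝ) + u * I with hs
    have hre : s.re = 1 := by simp [hs]
    have hs0 : 0 < ‖s‖ := by linarith
    have hu0 : 0 < |u| := abs_pos.2 hu
    have hsα : 1 ≤ ‖s‖ ^ α := Real.one_le_rpow hs1 h0.le
    have hsuα : |u| ^ α ≤ ‖s‖ ^ α := Real.rpow_le_rpow hu0.le hsu h0.le
    have h := norm_mittagLefflerKernel_le (β := α) h0 (hK r s (by simp [hre])).2
    rw [hre, sub_self, abs_zero, zero_mul, zero_add] at h
    have hpow : ‖s‖ ^ (-(α + 1)) * (‖s‖ ^ α) ^ 2 = ‖s‖ ^ (α - 1) := by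
      rw [sq, ← Real.rpow_add hs0, ← Real.rpow_add hs0]
      congr 1
      ring
    have hden : (|u| ^ α + (1 + |r|)) / 2 ≤ ‖s‖ ^ α + |r| := by linarith [abs_nonneg r]
    calc _ ≤ _ := h
      _ = Real.exp 1 * α * K ^ 2 *
          (‖s‖ ^ (-(α + 1)) * (‖s‖ ^ α) ^ 2 / (‖s‖ ^ α + |r|) ^ 2) := by
        rw [mul_pow, div_pow]
        ring
      _ = Real.exp 1 * α * K ^ 2 * (‖s‖ ^ (α - 1) / (‖s‖ ^ α + |r|) ^ 2) := by rw [hpow]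
      _ ≤ Real.exp 1 * α * K ^ 2 * (|u| ^ (α - 1) / ((|u| ^ α + (1 + |r|)) / 2) ^ 2) := by
        have := Real.rpow_le_rpow_of_nonpos hu0 hsu (by linarith : α - 1 ≤ 0)
        gcongr
      _ = Real.exp 1 * α * K ^ 2 * 4 * (|u| ^ (α - 1) / (|u| ^ α + (1 + |r|)) ^ 2) := by
        field_simp
        norm_num

end

/-- For `0 < α < 1` there is `C > 0` such that `|E_{α,1}(ir)| ≤ C/(1+|r|)` and
`|E_{α,α}(ir)| ≤ C/(1+|r|)` for every real `r`; in particular `E_{α,1}` and `E_{α,α}`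
are bounded on the imaginary axis. -/
theorem mittagLeffler_bounded_on_imaginary_axis (α : ℝ) (h0 : 0 < α) (h1 : α < 1) :
    ∃ C > 0, ∀ r : ℝ,
      ‖mittagLeffler α 1 (Complex.I * (r : ℂ))‖ ≤ C / (1 + |r|) ∧
      ‖mittagLeffler α α (Complex.I * (r : ℂ))‖ ≤ C / (1 + |r|) := by
  obtain ⟨C₁, hC₁, h₁⟩ := exists_norm_mittagLeffler_one_le h0 h1
  obtain ⟨C₂, hC₂, h₂⟩ := exists_norm_mittagLeffler_self_le h0 h1
  refine ⟨max C₁ C₂, lt_max_of_lt_left hC₁, fun r ↦ ⟨(h₁ r).trans ?_, (h₂ r).trans ?_⟩⟩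
  · gcongr
    exact le_max_left _ _
  · gcongr
    exact le_max_right _ _
end

section
/- Let 0 < α < 1, λ ≥ 0, and let f : [0,∞) → ℂ be twice continuously differentiable with compact support contained in (0,∞). Then u(t) := ∫_0^t K_λ(t−τ) f(τ) dτ is continuously differentiable on [0,∞) with u(0) = 0 and u′(t) = ∫_0^t K_λ(t−τ) f′(τ) dτ, its Caputo derivative ∂_t^α u(t) is well defined for t > 0, and u solves the fractional ODE i ∂_t^α u(t) + λ u(t) = f(t) for all t > 0. -/
/-- The kernel `K_λ(t) = -i t^{α-1} E_{α,α}(i λ t^α)`. -/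
noncomputable def fracKernel (α lam t : ℝ) : ℂ :=
  -Complex.I * ((t ^ (α - 1) : ℝ) : ℂ) *
    mittagLeffler α α (Complex.I * (lam : ℂ) * ((t ^ α : ℝ) : ℂ))

/-- The convolution solution `u(t) = ∫_0^t K_λ(t-τ) f(τ) dτ`. -/
noncomputable def convSol (α lam : ℝ) (f : ℝ → ℂ) (t : ℝ) : ℂ :=
  ∫ τ in (0:ℝ)..t, fracKernel α lam (t - τ) * f τ

/-- The Caputo fractional derivative of order `α`:
`∂_t^α u(t) = (1/Γ(1-α)) ∫_0^t (t-τ)^{-α} u'(τ) dτ`. -/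
noncomputable def caputoDeriv (α : ℝ) (u : ℝ → ℂ) (t : ℝ) : ℂ :=
  (Real.Gamma (1 - α) : ℂ)⁻¹ * ∫ τ in (0:ℝ)..t, (((t - τ) ^ (-α) : ℝ) : ℂ) * deriv u τ

open MeasureTheory Set

open ContinuousLinearMap (mul)

theorem rpow_mul_exp_neg_le_Gamma {x M : ℝ} (hx : 1 ≤ x) (hM : 0 < M) :
    M ^ (x - 1) * Real.exp (-M) ≤ Real.Gamma x := by
  have hint := Real.GammaIntegral_convergent (s := x) (by linarith)
  have hexp : IntegrableOn (fun t : ℝ => Real.exp (-t)) (Ioi M) := by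
    simpa using integrableOn_exp_neg_Ioi M
  rw [Real.Gamma_eq_integral (by linarith), ← integral_exp_neg_Ioi, ← integral_const_mul]
  calc ∫ t in Ioi M, M ^ (x - 1) * Real.exp (-t)
      ≤ ∫ t in Ioi M, Real.exp (-t) * t ^ (x - 1) := by
        refine setIntegral_mono_on (hexp.const_mul _) (hint.mono_set (Ioi_subset_Ioi hM.le))
          measurableSet_Ioi fun t ht => ?_
        rw [mul_comm]
        exact mul_le_mul_of_nonneg_left
          (Real.rpow_le_rpow hM.le (le_of_lt ht) (by linarith)) (Real.exp_pos _).le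
    _ ≤ _ := by
        refine setIntegral_mono_set hint ?_ (Ioi_subset_Ioi hM.le).eventuallyLE
        filter_upwards [ae_restrict_mem measurableSet_Ioi] with t ht
        have : (0 : ℝ) < t := ht
        positivity

theorem summable_pow_div_Gamma {a b : ℝ} (ha : 0 < a) (R : ℝ) :
    Summable fun k : ℕ => R ^ k / Real.Gamma (k * a + b) := by
  obtain ⟨M, hM0, hM⟩ : ∃ M : ℝ, 0 < M ∧ M ^ a = 2 * (|R| + 1) :=
    ⟨(2 * (|R| + 1)) ^ a⁻¹, by positivity, Real.rpow_inv_rpow (by positivity) ha.ne'⟩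
  have hq : |R| / M ^ a < 1 := by
    rw [hM, div_lt_one (by positivity)]
    linarith [abs_nonneg R]
  have hgeo : Summable fun k : ℕ =>
      (|R| / M ^ a) ^ k * (Real.exp M * M ^ (1 - b)) :=
    (summable_geometric_of_lt_one (by positivity) hq).mul_right _
  refine Summable.of_norm_bounded_eventually_nat hgeo ?_
  have hlim : Filter.Tendsto (fun k : ℕ => (k : ℝ) * a + b) Filter.atTop Filter.atTop :=
    Filter.tendsto_atTop_add_const_right _ _ (tendsto_natCast_atTop_atTop.atTop_mul_const ha)
  filter_upwards [hlim.eventually_ge_atTop 1] with k hk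
  have hΓ := rpow_mul_exp_neg_le_Gamma hk hM0
  have hpos : 0 < M ^ ((k : ℝ) * a + b - 1) * Real.exp (-M) := by positivity
  rw [norm_div, norm_pow, Real.norm_eq_abs, Real.norm_eq_abs, abs_of_pos (hpos.trans_le hΓ)]
  calc |R| ^ k / Real.Gamma (k * a + b)
      ≤ |R| ^ k / (M ^ ((k : ℝ) * a + b - 1) * Real.exp (-M)) := by gcongr
    _ = _ := by
      rw [show (k : ℝ) * a + b - 1 = a * k - (1 - b) by ring, Real.rpow_sub hM0,
        Real.rpow_mul hM0.le, Real.rpow_natCast, Real.exp_neg, div_pow]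
      field_simp

theorem norm_mittagLeffler_term {a b : ℝ} (ha : 0 < a) (hb : 0 < b) (z : ℂ) (k : ℕ) :
    ‖z ^ k / (Real.Gamma (k * a + b) : ℂ)‖ = ‖z‖ ^ k / Real.Gamma (k * a + b) := by
  rw [norm_div, norm_pow, Complex.norm_real, Real.norm_eq_abs,
    abs_of_pos (Real.Gamma_pos_of_pos (by positivity))]

theorem summable_mittagLeffler {a b : ℝ} (ha : 0 < a) (hb : 0 < b) (z : ℂ) :
    Summable fun k : ℕ => z ^ k / (Real.Gamma (k * a + b) : ℂ) := by
  refine Summable.of_norm ?_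
  simp_rw [norm_mittagLeffler_term ha hb]
  exact summable_pow_div_Gamma ha _

theorem continuous_mittagLeffler {a b : ℝ} (ha : 0 < a) (hb : 0 < b) :
    Continuous (mittagLeffler a b) := by
  refine continuous_iff_continuousAt.2 fun z => ?_
  have hball : ContinuousOn (mittagLeffler a b) (Metric.ball 0 (‖z‖ + 1)) := by
    refine continuousOn_tsum (fun k => by fun_prop) (summable_pow_div_Gamma (b := b) ha (‖z‖ + 1))
      fun k w hw => ?_
    rw [norm_mittagLeffler_term ha hb]
    have hw' : ‖w‖ ≤ ‖z‖ + 1 := by simpa using (mem_ball_zero_iff.1 hw).le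
    have := Real.Gamma_pos_of_pos (show 0 < (k : ℝ) * a + b by positivity)
    gcongr
  exact hball.continuousAt (Metric.isOpen_ball.mem_nhds (by simp))

/-- The recurrence `E_{a,b}(z) = 1 / Γ(b) + z E_{a,a+b}(z)`. -/
theorem mittagLeffler_eq_add_mul {a b : ℝ} (ha : 0 < a) (hb : 0 < b) (z : ℂ) :
    mittagLeffler a b z = (Real.Gamma b : ℂ)⁻¹ + z * mittagLeffler a (a + b) z := by
  rw [mittagLeffler, (summable_mittagLeffler ha hb z).tsum_eq_zero_add, mittagLeffler,
    ← tsum_mul_left]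
  congr 1
  · simp
  · refine tsum_congr fun k => ?_
    rw [show ((k + 1 : ℕ) : ℝ) * a + b = k * a + (a + b) by push_cast; ring, pow_succ]
    ring

/-- The power `s ↦ s ^ (b - 1)` on `(0, ∞)`, extended by zero. -/
noncomputable def posPow (b : ℝ) : ℝ → ℝ := (Ioi 0).indicator fun s => s ^ (b - 1)

theorem posPow_of_pos {b s : ℝ} (hs : 0 < s) : posPow b s = s ^ (b - 1) :=
  indicator_of_mem (mem_Ioi.2 hs) _

theorem posPow_of_nonpos {b s : ℝ} (hs : s ≤ 0) : posPow b s = 0 :=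
  indicator_of_notMem (by simpa using hs) _

theorem posPow_nonneg (b s : ℝ) : 0 ≤ posPow b s :=
  indicator_nonneg (fun _ hx => Real.rpow_nonneg (le_of_lt hx) _) s

theorem locallyIntegrable_posPow {b : ℝ} (hb : 0 < b) : LocallyIntegrable (posPow b) := by
  have h : LocallyIntegrable fun s : ℝ => s ^ (b - 1) := by
    refine locallyIntegrable_iff.2 fun K hK => ?_
    obtain ⟨r, hr0, hr⟩ := hK.isBounded.subset_closedBall_lt 0 0
    rw [Real.closedBall_eq_Icc] at hr
    exact ((intervalIntegrable_iff_integrableOn_Icc_of_le (by linarith)).1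
      (intervalIntegral.intervalIntegrable_rpow' (by linarith))).mono_set hr
  exact h.indicator measurableSet_Ioi

theorem locallyIntegrable_posPow_mul {b : ℝ} (hb : 0 < b) {C : ℝ → ℂ} (hC : Continuous C) :
    LocallyIntegrable fun s => (posPow b s : ℂ) * C s := by
  have h : LocallyIntegrable fun s => (posPow b s : ℂ) :=
    locallyIntegrable_iff.2 fun K hK =>
      ((locallyIntegrable_posPow hb).integrableOn_isCompact hK).ofReal
  exact h.smul_continuous hC

theorem posPow_mul_posPow_sub_eq_zero {a b s t : ℝ} (h : t ∉ Ioo 0 s) :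
    posPow a t * posPow b (s - t) = 0 := by
  rcases le_or_gt t 0 with h0 | h0
  · rw [posPow_of_nonpos h0, zero_mul]
  · rw [posPow_of_nonpos (b := b) (sub_nonpos.2 (not_lt.1 fun h' => h ⟨h0, h'⟩)), mul_zero]

theorem integral_posPow_mul_posPow {a b : ℝ} (ha : 0 < a) (hb : 0 < b) (s : ℝ) :
    ∫ t, posPow a t * posPow b (s - t) =
      Real.Gamma a * Real.Gamma b / Real.Gamma (a + b) * posPow (a + b) s := by
  rcases le_or_gt s 0 with hs | hs
  · rw [posPow_of_nonpos hs, mul_zero]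
    refine integral_eq_zero_of_ae (Filter.Eventually.of_forall fun t =>
      posPow_mul_posPow_sub_eq_zero fun h => ?_)
    linarith [h.1, h.2]
  have hbeta := Complex.betaIntegral_scaled a b hs
  rw [Complex.betaIntegral_eq_Gamma_mul_div _ _ (by simpa) (by simpa)] at hbeta
  rw [← setIntegral_eq_integral_of_forall_compl_eq_zero (s := Ioo 0 s)
    (fun t ht => posPow_mul_posPow_sub_eq_zero ht), ← integral_Ioc_eq_integral_Ioo,
    ← intervalIntegral.integral_of_le hs.le, posPow_of_pos hs]
  apply Complex.ofReal_injective
  rw [← intervalIntegral.integral_ofReal]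
  refine Eq.trans ?_ (hbeta.trans ?_)
  · rw [intervalIntegral.integral_of_le hs.le, intervalIntegral.integral_of_le hs.le,
      integral_Ioc_eq_integral_Ioo, integral_Ioc_eq_integral_Ioo]
    refine setIntegral_congr_fun measurableSet_Ioo fun t ht => ?_
    have h1 : 0 < s - t := sub_pos.2 ht.2
    simp only [posPow_of_pos ht.1, posPow_of_pos h1]
    push_cast [Complex.ofReal_cpow ht.1.le, Complex.ofReal_cpow h1.le]
    rfl
  · push_cast [Complex.ofReal_cpow hs.le, ← Complex.Gamma_ofReal]
    ring

theorem integrable_posPow_mul_posPow {a b : ℝ} (ha : 0 < a) (hb : 0 < b) (s : ℝ) :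
    Integrable fun t => posPow a t * posPow b (s - t) := by
  rcases le_or_gt s 0 with hs | hs
  · have h : (fun t => posPow a t * posPow b (s - t)) = 0 := by
      funext t
      refine posPow_mul_posPow_sub_eq_zero fun h => ?_
      linarith [h.1, h.2]
    rw [h]
    exact integrable_zero _ _ _
  · refine not_imp_comm.1 integral_undef ?_
    rw [integral_posPow_mul_posPow ha hb, posPow_of_pos hs]
    have := Real.Gamma_pos_of_pos ha
    have := Real.Gamma_pos_of_pos hb
    have := Real.Gamma_pos_of_pos (add_pos ha hb)
    positivity

/-- The function `s ↦ s ^ (b - 1) E_{a,b}(z s ^ a)` on `(0, ∞)`, extended by zero. -/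
noncomputable def mlKernel (a b : ℝ) (z : ℂ) (s : ℝ) : ℂ :=
  (posPow b s : ℂ) * mittagLeffler a b (z * ((s ^ a : ℝ) : ℂ))

theorem continuous_mittagLeffler_rpow {a b : ℝ} (ha : 0 < a) (hb : 0 < b) (z : ℂ) :
    Continuous fun s : ℝ => mittagLeffler a b (z * ((s ^ a : ℝ) : ℂ)) := by
  have h : Continuous fun s : ℝ => s ^ a := Real.continuous_rpow_const ha.le
  exact (continuous_mittagLeffler ha hb).comp (by fun_prop)

theorem locallyIntegrable_mlKernel {a b : ℝ} (ha : 0 < a) (hb : 0 < b) (z : ℂ) :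
    LocallyIntegrable (mlKernel a b z) :=
  locallyIntegrable_posPow_mul hb (continuous_mittagLeffler_rpow ha hb z)

theorem posPow_add_nat_mul (a b : ℝ) (n : ℕ) (s : ℝ) :
    posPow (n * a + b) s = posPow b s * (s ^ a) ^ n := by
  rcases le_or_gt s 0 with hs | hs
  · simp [posPow_of_nonpos hs]
  · rw [posPow_of_pos hs, posPow_of_pos hs, ← Real.rpow_natCast, ← Real.rpow_mul hs.le,
      ← Real.rpow_add hs]
    congr 1
    ring

theorem mlKernel_eq_tsum (a b : ℝ) (z : ℂ) (s : ℝ) :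
    mlKernel a b z s =
      ∑' n : ℕ, z ^ n / (Real.Gamma (n * a + b) : ℂ) * (posPow (n * a + b) s : ℂ) := by
  rw [mlKernel, mittagLeffler, ← tsum_mul_left]
  refine tsum_congr fun n => ?_
  rw [posPow_add_nat_mul]
  push_cast
  ring

theorem convolutionExistsAt_posPow_mlKernel {a b c : ℝ} (ha : 0 < a) (hb : 0 < b) (hc : 0 < c)
    (z : ℂ) (s : ℝ) :
    ConvolutionExistsAt (fun t => (posPow c t : ℂ)) (mlKernel a b z) s (mul ℝ ℂ) := by
  have hcont : Continuous fun t : ℝ => mittagLeffler a b (z * (((s - t) ^ a : ℝ) : ℂ)) :=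
    (continuous_mittagLeffler_rpow ha hb z).comp (continuous_const.sub continuous_id)
  have hint := ((integrable_posPow_mul_posPow hc hb s).ofReal (𝕜 := ℂ)).integrableOn
    (s := Icc 0 s)
  have h := hint.mul_continuousOn hcont.continuousOn isCompact_Icc
  refine ((integrableOn_iff_integrable_of_support_subset ?_).1 h).congr
    (Filter.Eventually.of_forall fun t => ?_)
  · refine Function.support_subset_iff'.2 fun t ht => ?_
    rw [posPow_mul_posPow_sub_eq_zero fun h' => ht (Ioo_subset_Icc_self h')]
    simp
  · simp [mlKernel, mul_assoc]

/-- Riemann–Liouville integration of `s ^ (b - 1) E_{a,b}(z s ^ a)` raises the second index. -/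
theorem convolution_posPow_mlKernel {a b c : ℝ} (ha : 0 < a) (hb : 0 < b) (hc : 0 < c)
    (z : ℂ) :
    convolution (fun t => (posPow c t : ℂ)) (mlKernel a b z) (mul ℝ ℂ) =
      fun s => (Real.Gamma c : ℂ) * mlKernel a (c + b) z s := by
  funext s
  have hpos (n : ℕ) : 0 < (n : ℝ) * a + b := by positivity
  let F : ℕ → ℝ → ℂ := fun n t =>
    z ^ n / (Real.Gamma (n * a + b) : ℂ) * ((posPow c t * posPow (n * a + b) (s - t) : ℝ) : ℂ)
  have hF (n : ℕ) : Integrable (F n) :=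
    ((integrable_posPow_mul_posPow hc (hpos n) s).ofReal (𝕜 := ℂ)).const_mul _
  have hnorm (n : ℕ) : ∫ t, ‖F n t‖ =
      Real.Gamma c * posPow (c + b) s * ((‖z‖ * s ^ a) ^ n / Real.Gamma (n * a + (c + b))) := by
    have h1 (t : ℝ) : ‖F n t‖ = ‖z‖ ^ n / Real.Gamma (n * a + b) *
        (posPow c t * posPow (n * a + b) (s - t)) := by
      rw [norm_mul, norm_mittagLeffler_term ha hb, Complex.norm_real, Real.norm_of_nonneg
        (mul_nonneg (posPow_nonneg _ _) (posPow_nonneg _ _))]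
    simp_rw [h1]
    rw [integral_const_mul, integral_posPow_mul_posPow hc (hpos n),
      show c + ((n : ℝ) * a + b) = n * a + (c + b) by ring, posPow_add_nat_mul]
    have := (Real.Gamma_pos_of_pos (hpos n)).ne'
    rw [mul_pow]
    field_simp
  have hsum : Summable fun n => ∫ t, ‖F n t‖ := by
    simp_rw [hnorm]
    exact (summable_pow_div_Gamma ha _).mul_left _
  have key := (hasSum_integral_of_summable_integral_norm hF hsum).tsum_eq
  rw [convolution_def]
  calc ∫ t, mul ℝ ℂ (posPow c t : ℂ) (mlKernel a b z (s - t))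
      = ∫ t, ∑' n, F n t := by
        refine integral_congr_ae (Filter.Eventually.of_forall fun t => ?_)
        simp only [ContinuousLinearMap.mul_apply', mlKernel_eq_tsum, ← tsum_mul_left, F]
        refine tsum_congr fun n => ?_
        push_cast
        ring
    _ = ∑' n, ∫ t, F n t := key.symm
    _ = _ := by
        rw [mlKernel_eq_tsum, ← tsum_mul_left]
        refine tsum_congr fun n => ?_
        simp only [F]
        rw [integral_const_mul, integral_complex_ofReal, integral_posPow_mul_posPow hc (hpos n),
          show c + ((n : ℝ) * a + b) = n * a + (c + b) by ring]
        have : (Real.Gamma (n * a + b) : ℂ) ≠ 0 :=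
          Complex.ofReal_ne_zero.2 (Real.Gamma_pos_of_pos (hpos n)).ne'
        push_cast
        field_simp

/-- The convolution of functions supported on the positive half-line is an integral over
`[0, t]`. -/
theorem convolution_eq_intervalIntegral {k φ g : ℝ → ℂ} (hk : ∀ s, 0 < s → k s = φ s)
    (hk0 : ∀ s ≤ 0, k s = 0) (hg : ∀ s ≤ 0, g s = 0) (t : ℝ) :
    convolution k g (mul ℝ ℂ) volume t = ∫ τ in (0 : ℝ)..t, φ (t - τ) * g τ := by
  rw [convolution_eq_swap]
  simp only [ContinuousLinearMap.mul_apply']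
  have hzero : ∀ τ ∉ Ioo 0 t, k (t - τ) * g τ = 0 := fun τ hτ => by
    rcases le_or_gt τ 0 with h | h
    · rw [hg τ h, mul_zero]
    · rw [hk0 _ (sub_nonpos.2 (not_lt.1 fun h' => hτ ⟨h, h'⟩)), zero_mul]
  rw [← setIntegral_eq_integral_of_forall_compl_eq_zero hzero]
  rcases le_total 0 t with ht | ht
  · rw [intervalIntegral.integral_of_le ht, integral_Ioc_eq_integral_Ioo]
    exact setIntegral_congr_fun measurableSet_Ioo fun τ hτ => by
      simp only [hk _ (sub_pos.2 hτ.2)]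
  · rw [Ioo_eq_empty ht.not_gt, setIntegral_empty, intervalIntegral.integral_of_ge ht,
      setIntegral_eq_zero_of_forall_eq_zero fun τ hτ => by rw [hg τ hτ.2, mul_zero], neg_zero]

theorem convolutionExistsAt_of_continuous {E : Type*} [NormedRing E] [NormedAlgebra ℝ E]
    {k g : ℝ → E} (hk : LocallyIntegrable k) (hk0 : ∀ s ≤ 0, k s = 0) (hg : Continuous g)
    (hg0 : ∀ s ≤ 0, g s = 0) (t : ℝ) : ConvolutionExistsAt k g t (mul ℝ E) volume := by
  have hcont : Continuous fun s => g (t - s) := hg.comp (continuous_const.sub continuous_id)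
  refine (integrableOn_iff_integrable_of_support_subset (s := Icc 0 t) ?_).1
    ((hk.integrableOn_isCompact isCompact_Icc).mul_continuousOn hcont.continuousOn isCompact_Icc)
  refine Function.support_subset_iff'.2 fun s hs => ?_
  rcases le_or_gt s 0 with h | h
  · simp [hk0 s h]
  · simp [hg0 (t - s) (sub_nonpos.2 (not_le.1 fun h' => hs ⟨h.le, h'⟩).le)]

theorem mlKernel_of_nonpos {a b : ℝ} {z : ℂ} {s : ℝ} (hs : s ≤ 0) : mlKernel a b z s = 0 := by
  simp [mlKernel, posPow_of_nonpos hs]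

theorem convolution_eq_zero_of_nonpos {E : Type*} [NormedRing E] [NormedAlgebra ℝ E]
    {k g : ℝ → E} (hk0 : ∀ s ≤ 0, k s = 0) (hg0 : ∀ s ≤ 0, g s = 0) {t : ℝ} (ht : t ≤ 0) :
    convolution k g (mul ℝ E) volume t = 0 := by
  rw [convolution_def]
  refine integral_eq_zero_of_ae (Filter.Eventually.of_forall fun s => ?_)
  rcases le_or_gt s 0 with h | h
  · simp [hk0 s h]
  · simp [hg0 (t - s) (by linarith)]

theorem posPow_convolution_assoc {c : ℝ} (hc : 0 < c) {k g : ℝ → ℂ} (hk : LocallyIntegrable k)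
    (hk0 : ∀ s ≤ 0, k s = 0)
    (hck : ∀ s, ConvolutionExistsAt (fun t => (posPow c t : ℂ)) k s (mul ℝ ℂ) volume)
    (hg : Continuous g) (hgc : HasCompactSupport g) (hg0 : ∀ s ≤ 0, g s = 0) (t : ℝ) :
    convolution (convolution (fun t => (posPow c t : ℂ)) k (mul ℝ ℂ) volume) g (mul ℝ ℂ) volume t =
      convolution (fun t => (posPow c t : ℂ)) (convolution k g (mul ℝ ℂ) volume)
        (mul ℝ ℂ) volume t := by
  have hp : LocallyIntegrable fun t => (posPow c t : ℂ) := by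
    simpa using locallyIntegrable_posPow_mul hc (continuous_const (y := (1 : ℂ)))
  have hkn : LocallyIntegrable fun s => ‖k s‖ := fun s => IntegrableAtFilter.norm (hk s)
  have hpn : LocallyIntegrable fun t => ‖(posPow c t : ℂ)‖ := fun s =>
    IntegrableAtFilter.norm (hp s)
  refine convolution_assoc (mul ℝ ℂ) (mul ℝ ℂ) (mul ℝ ℂ) (mul ℝ ℂ) (fun x y z => mul_assoc x y z)
    hp.aestronglyMeasurable hk.aestronglyMeasurable hg.aestronglyMeasurable
    (Filter.Eventually.of_forall hck)
    (Filter.Eventually.of_forall fun s => hgc.norm.convolutionExists_right _ hkn hg.norm s) ?_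
  exact convolutionExistsAt_of_continuous hpn (fun s hs => by simp [posPow_of_nonpos hs])
    (hgc.norm.continuous_convolution_right _ hkn hg.norm)
    (fun s hs => convolution_eq_zero_of_nonpos (fun s hs => by simp [hk0 s hs])
      (fun s hs => by simp [hg0 s hs]) hs) t

theorem convolution_posPow_one_deriv {g g' : ℝ → ℂ} (hg : ∀ t, HasDerivAt g (g' t) t)
    (hg' : Continuous g') (hg0 : ∀ s ≤ 0, g s = 0) (hg'0 : ∀ s ≤ 0, g' s = 0) (t : ℝ) :
    convolution (fun t => (posPow 1 t : ℂ)) g' (mul ℝ ℂ) volume t = g t := by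
  rw [convolution_eq_intervalIntegral (φ := fun _ => 1) (fun s hs => by simp [posPow_of_pos hs])
    (fun s hs => by simp [posPow_of_nonpos hs]) hg'0]
  simp only [one_mul]
  rw [intervalIntegral.integral_eq_sub_of_hasDerivAt (fun s _ => hg s)
    (hg'.intervalIntegrable _ _), hg0 0 le_rfl, sub_zero]

theorem convolution_posPow_one_sub_mlKernel {a : ℝ} (h0 : 0 < a) (h1 : a < 1) (z : ℂ) (s : ℝ) :
    convolution (fun t => (posPow (1 - a) t : ℂ)) (mlKernel a a z) (mul ℝ ℂ) volume s =
      (Real.Gamma (1 - a) : ℂ) * ((posPow 1 s : ℂ) +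
        z * convolution (fun t => (posPow 1 t : ℂ)) (mlKernel a a z) (mul ℝ ℂ) volume s) := by
  rw [convolution_posPow_mlKernel h0 h0 (sub_pos.2 h1), convolution_posPow_mlKernel h0 h0 one_pos]
  simp only [mlKernel, sub_add_cancel, Real.Gamma_one, Complex.ofReal_one, one_mul]
  rw [mittagLeffler_eq_add_mul h0 one_pos, Real.Gamma_one, add_comm a 1]
  have h : posPow (1 + a) s = posPow 1 s * s ^ a := by
    simpa [add_comm] using posPow_add_nat_mul a 1 1 s
  rw [h]
  push_cast
  ring

/-- The fractional kernel, cut off to `(0, ∞)`, solves the convolution form of the fractional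
equation. -/
theorem convolution_posPow_convolution_mlKernel {a : ℝ} (h0 : 0 < a) (h1 : a < 1) (z : ℂ)
    {g g' : ℝ → ℂ} (hg : ∀ t, HasDerivAt g (g' t) t) (hg' : Continuous g')
    (hgc' : HasCompactSupport g') (hg0 : ∀ s ≤ 0, g s = 0) (hg'0 : ∀ s ≤ 0, g' s = 0)
    (hu : ∀ t, HasDerivAt (convolution (mlKernel a a z) g (mul ℝ ℂ) volume)
      (convolution (mlKernel a a z) g' (mul ℝ ℂ) volume t) t) (t : ℝ) :
    convolution (fun t => (posPow (1 - a) t : ℂ))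
        (convolution (mlKernel a a z) g' (mul ℝ ℂ) volume) (mul ℝ ℂ) volume t =
      (Real.Gamma (1 - a) : ℂ) * (g t + z * convolution (mlKernel a a z) g (mul ℝ ℂ) volume t) := by
  have hk := locallyIntegrable_mlKernel h0 h0 z
  have hk0 : ∀ s ≤ 0, mlKernel a a z s = 0 := fun s hs => mlKernel_of_nonpos hs
  have hexists {c : ℝ} (hc : 0 < c) := convolutionExistsAt_posPow_mlKernel h0 h0 hc z
  have hp : LocallyIntegrable fun t => (posPow 1 t : ℂ) := by
    simpa using locallyIntegrable_posPow_mul one_pos (continuous_const (y := (1 : ℂ)))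
  have hq : LocallyIntegrable
      (convolution (fun t => (posPow 1 t : ℂ)) (mlKernel a a z) (mul ℝ ℂ) volume) := by
    rw [convolution_posPow_mlKernel h0 h0 one_pos]
    simpa using locallyIntegrable_mlKernel h0 (add_pos one_pos h0) z
  have hpi := hgc'.convolutionExists_right (mul ℝ ℂ) hp hg' t
  have hqi := hgc'.convolutionExists_right (mul ℝ ℂ) hq hg' t
  have hone := posPow_convolution_assoc one_pos hk hk0 (hexists one_pos) hg' hgc' hg'0 t
  rw [convolution_posPow_one_deriv hu (hgc'.continuous_convolution_right _ hk hg')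
    (fun s hs => convolution_eq_zero_of_nonpos hk0 hg0 hs)
    (fun s hs => convolution_eq_zero_of_nonpos hk0 hg'0 hs)] at hone
  rw [← posPow_convolution_assoc (sub_pos.2 h1) hk hk0 (hexists (sub_pos.2 h1)) hg' hgc' hg'0,
    ← hone, ← convolution_posPow_one_deriv hg hg' hg0 hg'0 t]
  rw [convolution_def, funext (convolution_posPow_one_sub_mlKernel h0 h1 z), convolution_def,
    convolution_def, ← integral_const_mul z, ← integral_add hpi (hqi.const_mul z),
    ← integral_const_mul]
  refine integral_congr_ae (Filter.Eventually.of_forall fun s => ?_)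
  simp only [ContinuousLinearMap.mul_apply']
  ring

theorem convSol_eq_convolution (α lam : ℝ) {g : ℝ → ℂ} (hg0 : ∀ s ≤ 0, g s = 0) :
    convSol α lam g = fun t =>
      -Complex.I * convolution (mlKernel α α (Complex.I * lam)) g (mul ℝ ℂ) volume t := by
  funext t
  rw [convolution_eq_intervalIntegral (φ := fun s => Complex.I * fracKernel α lam s)
    (fun s hs => ?_) (fun s hs => mlKernel_of_nonpos hs) hg0, convSol,
    ← intervalIntegral.integral_const_mul]
  · refine intervalIntegral.integral_congr fun τ _ => ?_
    linear_combination ((fracKernel α lam (t - τ) * g τ)) * Complex.I_mul_I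
  · rw [mlKernel, fracKernel, posPow_of_pos hs]
    linear_combination (((s ^ (α - 1) : ℝ) : ℂ) *
      mittagLeffler α α (Complex.I * (lam : ℂ) * ((s ^ α : ℝ) : ℂ))) * Complex.I_mul_I

/-- For `0 < α < 1`, `λ ≥ 0` and `f` twice continuously differentiable with compact support
in `(0,∞)`, the function `u(t) = ∫_0^t K_λ(t-τ) f(τ) dτ` is continuously differentiable with
`u(0) = 0` and `u'(t) = ∫_0^t K_λ(t-τ) f'(τ) dτ`, its Caputo derivative is well defined for
`t > 0`, and `u` solves `i ∂_t^α u(t) + λ u(t) = f(t)` for all `t > 0`. -/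
theorem convSol_solves_fracODE (α lam : ℝ) (h0 : 0 < α) (h1 : α < 1) (hlam : 0 ≤ lam)
    (f : ℝ → ℂ) (hf : ContDiff ℝ 2 f) (hfc : HasCompactSupport f)
    (hfs : tsupport f ⊆ Set.Ioi 0) :
    convSol α lam f 0 = 0 ∧
    (∀ t : ℝ, HasDerivAt (convSol α lam f) (convSol α lam (deriv f) t) t) ∧
    ContinuousOn (convSol α lam (deriv f)) (Set.Ici 0) ∧
    (∀ t : ℝ, 0 < t →
      IntervalIntegrable
        (fun τ => (((t - τ) ^ (-α) : ℝ) : ℂ) * deriv (convSol α lam f) τ)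
        MeasureTheory.volume 0 t) ∧
    (∀ t : ℝ, 0 < t →
      Complex.I * caputoDeriv α (convSol α lam f) t + (lam : ℂ) * convSol α lam f t = f t) := by
  have hvan (s : ℝ) (hs : s ≤ 0) : s ∉ tsupport f := fun h => (hfs h).not_ge hs
  have hf0 : ∀ s ≤ 0, f s = 0 := fun s hs => image_eq_zero_of_notMem_tsupport (hvan s hs)
  have hf'0 : ∀ s ≤ 0, deriv f s = 0 := fun s hs =>
    Function.notMem_support.1 fun h => hvan s hs (support_deriv_subset h)
  have hf1 : ContDiff ℝ 1 f := hf.of_le one_le_two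
  have hf' : Continuous (deriv f) := hf1.continuous_deriv le_rfl
  have hfd (t : ℝ) : HasDerivAt f (deriv f t) t :=
    (hf1.differentiable one_ne_zero t).hasDerivAt
  set z : ℂ := Complex.I * lam with hz
  have hk := locallyIntegrable_mlKernel h0 h0 z
  have hu (t : ℝ) : HasDerivAt (convolution (mlKernel α α z) f (mul ℝ ℂ) volume)
      (convolution (mlKernel α α z) (deriv f) (mul ℝ ℂ) volume t) t :=
    hfc.hasDerivAt_convolution_right _ hk hf1 t
  have hw0 : ∀ s ≤ 0, convolution (mlKernel α α z) (deriv f) (mul ℝ ℂ) volume s = 0 := fun s hs =>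
    convolution_eq_zero_of_nonpos (fun s hs => mlKernel_of_nonpos hs) hf'0 hs
  have hwc : Continuous (convolution (mlKernel α α z) (deriv f) (mul ℝ ℂ) volume) :=
    hfc.deriv.continuous_convolution_right _ hk hf'
  have hderiv (t : ℝ) : HasDerivAt (convSol α lam f) (convSol α lam (deriv f) t) t := by
    rw [convSol_eq_convolution α lam hf0, convSol_eq_convolution α lam hf'0]
    exact (hu t).const_mul _
  have hcont : Continuous (convSol α lam (deriv f)) := by
    rw [convSol_eq_convolution α lam hf'0]
    exact continuous_const.mul hwc
  have hdu : deriv (convSol α lam f) = convSol α lam (deriv f) :=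
    funext fun t => (hderiv t).deriv
  refine ⟨by simp [convSol], hderiv, hcont.continuousOn, fun t ht => ?_, fun t ht => ?_⟩
  · rw [hdu]
    have hpow : IntervalIntegrable (fun τ => (t - τ) ^ (-α)) volume 0 t := by
      simpa using ((intervalIntegral.intervalIntegrable_rpow' (a := 0) (b := t)
        (neg_lt_neg h1)).comp_sub_left t).symm
    exact IntervalIntegrable.mul_continuousOn ⟨hpow.1.ofReal, hpow.2.ofReal⟩ hcont.continuousOn
  · have hconv := convolution_posPow_convolution_mlKernel h0 h1 z hfd hf' hfc.deriv hf0 hf'0 hu t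
    rw [convolution_eq_intervalIntegral (φ := fun s => ((s ^ (-α) : ℝ) : ℂ))
      (fun s hs => by rw [posPow_of_pos hs]; congr 2; ring)
      (fun s hs => by simp [posPow_of_nonpos hs]) hw0] at hconv
    have hcaputo : ∫ τ in (0 : ℝ)..t, (((t - τ) ^ (-α) : ℝ) : ℂ) * convSol α lam (deriv f) τ =
        -Complex.I * ((Real.Gamma (1 - α) : ℂ) *
          (f t + z * convolution (mlKernel α α z) f (mul ℝ ℂ) volume t)) := by
      rw [← hconv, ← intervalIntegral.integral_const_mul, convSol_eq_convolution α lam hf'0]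
      refine intervalIntegral.integral_congr fun τ _ => ?_
      simp only [hz]
      ring
    have hΓ : (Real.Gamma (1 - α) : ℂ) ≠ 0 :=
      Complex.ofReal_ne_zero.2 (Real.Gamma_pos_of_pos (sub_pos.2 h1)).ne'
    rw [caputoDeriv, hdu, hcaputo, convSol_eq_convolution α lam hf0, mul_left_comm _ (-Complex.I),
      inv_mul_cancel_left₀ hΓ]
    simp only [← hz]
    rw [hz]
    linear_combination (-f t) * Complex.I_mul_I - Complex.I * lam *
      convolution (mlKernel α α (Complex.I * lam)) f (mul ℝ ℂ) volume t * Complex.I_mul_I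
end
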